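/- Let Θ ⊂ ℝ^d be a finite set satisfying Condition A, with 0 ∈ Θ and Θ = −Θ, and let G be the additive subgroup of ℝ^d generated by Θ. Let θ_1, …, θ_q ∈ G \ {0} be linearly independent over ℝ and let 𝔙 be their ℝ-linear span. Then G ∩ 𝔙 is a lattice in 𝔙: it is a discrete additive subgroup of 𝔙 whose ℝ-linear span is 𝔙. -/

import Mathlib

/-- Condition A: every finite family of elements of `Θ` that is linearly dependent over `ℝ`
admits a nontrivial integer linear dependence. -/
def ConditionA {d : ℕ} (Θ : Set (EuclideanSpace ℝ (Fin d))) : Prop :=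
  ∀ (m : ℕ) (θ : Fin m → EuclideanSpace ℝ (Fin d)),
    (∀ i, θ i ∈ Θ) → ¬ LinearIndependent ℝ θ →
      ∃ n : Fin m → ℤ, (∃ i, n i ≠ 0) ∧ ∑ i, (n i : ℝ) • θ i = 0

/-- Under Condition A, a vector of `Θ` in the real span of a linearly independent family of `Θ`
has a nonzero integer multiple in the integer span of that family. -/
theorem ConditionA.exists_zsmul_mem_span {d m : ℕ} {Θ : Set (EuclideanSpace ℝ (Fin d))}
    (hA : ConditionA Θ) {f : Fin m → EuclideanSpace ℝ (Fin d)} (hfΘ : ∀ i, f i ∈ Θ)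
    (hf : LinearIndependent ℝ f) {x : EuclideanSpace ℝ (Fin d)} (hx : x ∈ Θ)
    (hxf : x ∈ Submodule.span ℝ (Set.range f)) :
    ∃ N : ℤ, N ≠ 0 ∧ N • x ∈ Submodule.span ℤ (Set.range f) := by
  obtain ⟨n, ⟨j, hj⟩, hn⟩ := hA (m + 1) (Fin.cons x f)
    (fun i => by refine Fin.cases ?_ ?_ i <;> simp [hx, hfΘ])
    (fun h => (linearIndependent_finCons.1 h).2 hxf)
  simp only [Fin.sum_univ_succ, Fin.cons_zero, Fin.cons_succ, Int.cast_smul_eq_zsmul] at hn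
  refine ⟨n 0, fun h => hj ?_, ?_⟩
  · have hsum : ∑ i : Fin m, (n i.succ : ℝ) • f i = 0 := by
      simpa [h, Int.cast_smul_eq_zsmul] using hn
    have hzero := Fintype.linearIndependent_iff.1 hf _ hsum
    refine Fin.cases h (fun i => ?_) j
    exact_mod_cast hzero i
  · rw [eq_neg_of_add_eq_zero_left hn]
    exact neg_mem (sum_mem fun i _ =>
      Submodule.smul_mem _ _ (Submodule.subset_span (Set.mem_range_self i)))

/-- If every element of a finite set has a nonzero integer multiple in a subgroup, then a common
nonzero integer multiplies the generated group into that subgroup. -/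
theorem Set.Finite.exists_zsmul_closure_mem {M : Type*} [AddCommGroup M] {s : Set M}
    (hs : s.Finite) (L : Submodule ℤ M) (h : ∀ x ∈ s, ∃ N : ℤ, N ≠ 0 ∧ N • x ∈ L) :
    ∃ N : ℤ, N ≠ 0 ∧ ∀ x ∈ AddSubgroup.closure s, N • x ∈ L := by
  choose! N hN0 hN using h
  refine ⟨∏ y ∈ hs.toFinset, N y, Finset.prod_ne_zero_iff.2 fun y hy => hN0 y (by simpa using hy),
    fun x hx => ?_⟩
  induction hx using AddSubgroup.closure_induction with
  | mem x hx =>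
    obtain ⟨k, hk⟩ := Finset.dvd_prod_of_mem N (hs.mem_toFinset.2 hx)
    rw [hk, mul_comm, mul_smul]
    exact L.smul_mem k (hN x hx)
  | zero => simp
  | add x y _ _ hx hy => rw [smul_add]; exact add_mem hx hy
  | neg x _ hx => rw [smul_neg]; exact neg_mem hx

/-- The integer span of a real linearly independent set in a finite-dimensional space has no
nonzero elements of small norm. -/
theorem LinearIndepOn.exists_norm_lt_imp_eq_zero {E : Type*} [NormedAddCommGroup E]
    [NormedSpace ℝ E] [FiniteDimensional ℝ E] {b : Set E} (hb : LinearIndepOn ℝ id b) :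
    ∃ r > (0 : ℝ), ∀ x ∈ Submodule.span ℤ b, ‖x‖ < r → x = 0 := by
  let B := Module.Basis.extend hb
  have : Finite (hb.extend (Set.subset_univ b)) := Module.Finite.finite_basis B
  have hbB : b ⊆ Set.range B := by
    rw [Module.Basis.range_extend]
    exact hb.subset_extend _
  have hdisc : DiscreteTopology (Submodule.span ℤ (Set.range B)) := inferInstance
  obtain ⟨r, hr, h⟩ := Metric.isOpen_singleton_iff.1
    (isOpen_discrete ({0} : Set (Submodule.span ℤ (Set.range B))))
  refine ⟨r, hr, fun x hx hxr => ?_⟩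
  have := h ⟨x, Submodule.span_mono hbB hx⟩ (by simpa [dist_eq_norm] using hxr)
  simpa using this

/-- The group generated by a finite set satisfying Condition A is discrete. -/
theorem ConditionA.exists_norm_lt_imp_eq_zero {d : ℕ} {Θ : Set (EuclideanSpace ℝ (Fin d))}
    (hA : ConditionA Θ) (hfin : Θ.Finite) :
    ∃ r > (0 : ℝ), ∀ x ∈ AddSubgroup.closure Θ, ‖x‖ < r → x = 0 := by
  obtain ⟨b, hbΘ, hspan, hb⟩ := exists_linearIndependent ℝ Θ
  obtain ⟨m, f, hfinj, rfl⟩ := (hfin.subset hbΘ).fin_param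
  have hf : LinearIndependent ℝ f :=
    hb.comp (Set.rangeFactorization f) (Set.rangeFactorization_injective.2 hfinj)
  obtain ⟨N, hN0, hN⟩ := hfin.exists_zsmul_closure_mem (Submodule.span ℤ (Set.range f))
    fun x hx => hA.exists_zsmul_mem_span (fun i => hbΘ (Set.mem_range_self i)) hf hx
      (hspan ▸ Submodule.subset_span hx)
  obtain ⟨r, hr, h⟩ := LinearIndepOn.exists_norm_lt_imp_eq_zero hb
  have hNpos : 0 < |(N : ℝ)| := by positivity
  refine ⟨r / |(N : ℝ)|, by positivity, fun x hx hxr => ?_⟩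
  have hNx : N • x = 0 := h _ (hN x hx) (by
    rw [← Int.cast_smul_eq_zsmul ℝ, norm_smul, Real.norm_eq_abs, mul_comm]
    exact (lt_div_iff₀ hNpos).1 hxr)
  rw [← Int.cast_smul_eq_zsmul ℝ] at hNx
  exact (smul_eq_zero.1 hNx).resolve_left (Int.cast_ne_zero.2 hN0)

/-- Let `Θ` be a finite set satisfying Condition A, containing `0` and symmetric about `0`,
and let `G` be the additive subgroup generated by `Θ`.  If `θ_1, …, θ_q ∈ G \ {0}` are
linearly independent over `ℝ` with span `𝔙`, then `G ∩ 𝔙` is a lattice in `𝔙`: a discrete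
additive subgroup of `𝔙` whose `ℝ`-linear span is `𝔙`. -/
theorem stmt_5 (d q : ℕ) (Θ : Set (EuclideanSpace ℝ (Fin d))) (hfin : Θ.Finite)
    (hA : ConditionA Θ) (h0 : (0 : EuclideanSpace ℝ (Fin d)) ∈ Θ)
    (hsym : ∀ x ∈ Θ, -x ∈ Θ)
    (θ : Fin q → EuclideanSpace ℝ (Fin d))
    (hθG : ∀ i, θ i ∈ AddSubgroup.closure Θ) (hθ0 : ∀ i, θ i ≠ 0)
    (hind : LinearIndependent ℝ θ) :
    (∃ r > (0 : ℝ), ∀ x ∈ AddSubgroup.closure Θ,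
        x ∈ Submodule.span ℝ (Set.range θ) → ‖x‖ < r → x = 0) ∧
    Submodule.span ℝ ((AddSubgroup.closure Θ : Set (EuclideanSpace ℝ (Fin d))) ∩
        (Submodule.span ℝ (Set.range θ) : Set (EuclideanSpace ℝ (Fin d)))) =
      Submodule.span ℝ (Set.range θ) := by
  obtain ⟨r, hr, h⟩ := hA.exists_norm_lt_imp_eq_zero hfin
  refine ⟨⟨r, hr, fun x hx _ => h x hx⟩, le_antisymm ?_ ?_⟩
  · exact Submodule.span_le.2 Set.inter_subset_right
  · refine Submodule.span_mono (Set.range_subset_iff.2 fun i => ⟨hθG i, ?_⟩)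
    exact Submodule.subset_span (Set.mem_range_self i)
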